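/- arXiv:math/0608419 — 4 statements merged into one kernel-verified Lean document; each statement's English description precedes it below -/
import Mathlib

section
/- Let N be a string of digits a_1,...,a_n (each in {0,...,9}, n ≥ 1) having at least one nonzero entry. Then K^N_m ≥ L^n_{m−n} holds for every m ≥ n + 1. -/
/-- `keithList a m` is the list of the first `m` terms `K^N_1, …, K^N_m` of the Keith
sequence associated with the digit string `a = [a_1, …, a_n]` (most significant first):
`K^N_m = a_m` for `1 ≤ m ≤ n` and `K^N_m = K^N_{m-1} + ⋯ + K^N_{m-n}` for `m > n`. -/
def keithList (a : List ℕ) : ℕ → List ℕ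
  | 0 => []
  | m + 1 =>
      let prev := keithList a m
      prev ++ [if m < a.length then a.getD m 0 else (prev.drop (m - a.length)).sum]

/-- `keithSeq a m = K^N_m` (1-indexed; `keithSeq a 0 = 0` by convention). -/
def keithSeq (a : List ℕ) (m : ℕ) : ℕ := (keithList a m).getD (m - 1) 0

theorem keithSeq_succ_eq_ite (a : List ℕ) (m : ℕ) :
    keithSeq a (m + 1) =
      if m < a.length then a.getD m 0
      else ((keithList a m).drop (m - a.length)).sum := by
  have hlen : ∀ k, (keithList a k).length = k := by
    intro k
    induction k with
    | zero => rfl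
    | succ k ih => simp [keithList, ih]
  simp [keithSeq, keithList, List.getD_eq_getElem?_getD, hlen]

theorem keithList_eq_map (a : List ℕ) (m : ℕ) :
    keithList a m = (List.range m).map fun k => keithSeq a (k + 1) := by
  induction m with
  | zero => rfl
  | succ m ih =>
    rw [List.range_succ, List.map_append, ← ih, List.map_singleton, keithSeq_succ_eq_ite]
    rfl

theorem keithSeq_succ_of_lt {a : List ℕ} {m : ℕ} (h : m < a.length) :
    keithSeq a (m + 1) = a[m] := by
  simp [keithSeq_succ_eq_ite, h]

theorem keithSeq_add_length_succ (a : List ℕ) (k : ℕ) :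
    keithSeq a (k + a.length + 1) = ∑ i ∈ Finset.range a.length, keithSeq a (k + i + 1) := by
  rw [keithSeq_succ_eq_ite, if_neg (by omega), keithList_eq_map, Nat.add_sub_cancel,
    List.range_add, List.map_append, List.drop_left' (by simp), List.map_map]
  rfl

theorem keithSeq_length_succ_pos {a : List ℕ} (hnz : ∃ d ∈ a, d ≠ 0) :
    0 < keithSeq a (a.length + 1) := by
  obtain ⟨d, hd, hd0⟩ := hnz
  obtain ⟨i, hi, rfl⟩ := List.getElem_of_mem hd
  have hrec := keithSeq_add_length_succ a 0
  simp only [zero_add] at hrec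
  rw [hrec]
  refine Finset.sum_pos' (fun _ _ => Nat.zero_le _) ⟨i, Finset.mem_range.2 hi, ?_⟩
  rw [keithSeq_succ_of_lt hi]
  exact Nat.pos_of_ne_zero hd0

theorem keithSeq_pos_of_lt {a : List ℕ} (hnz : ∃ d ∈ a, d ≠ 0) {k : ℕ} (hk : k < a.length) :
    0 < keithSeq a (k + a.length + 1) := by
  rcases Nat.eq_zero_or_pos k with rfl | hpos
  · simpa using keithSeq_length_succ_pos hnz
  · rw [keithSeq_add_length_succ]
    refine Finset.sum_pos' (fun _ _ => Nat.zero_le _)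
      ⟨a.length - k, Finset.mem_range.2 (by omega), ?_⟩
    rw [Nat.add_sub_cancel' hk.le]
    exact keithSeq_length_succ_pos hnz

theorem keithSeq_replicate_one_le {a : List ℕ} (hnz : ∃ d ∈ a, d ≠ 0) (k : ℕ) :
    keithSeq (List.replicate a.length 1) (k + 1) ≤ keithSeq a (k + a.length + 1) := by
  induction k using Nat.strong_induction_on with
  | _ k ih =>
    rcases lt_or_ge k a.length with hk | hk
    · rw [keithSeq_succ_of_lt (by simpa using hk), List.getElem_replicate]
      exact keithSeq_pos_of_lt hnz hk
    · obtain ⟨j, rfl⟩ := Nat.exists_eq_add_of_le' hk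
      have hrec := keithSeq_add_length_succ (List.replicate a.length 1) j
      rw [List.length_replicate] at hrec
      rw [hrec, keithSeq_add_length_succ]
      refine Finset.sum_le_sum fun i hi => ?_
      have hlt := Finset.mem_range.1 hi
      rw [add_right_comm j a.length i]
      exact ih (j + i) (by omega)

/-- If the digit string a (length n ≥ 1, digits ≤ 9) has at least one nonzero entry,
then K^N_m ≥ L^n_{m−n} for every m ≥ n + 1. -/
theorem keith_ge_L_shift (a : List ℕ)
    (hn : 1 ≤ a.length) (hd : ∀ d ∈ a, d ≤ 9)
    (hnz : ∃ d ∈ a, d ≠ 0) :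
    ∀ m, a.length + 1 ≤ m →
      keithSeq (List.replicate a.length 1) (m - a.length) ≤ keithSeq a m := by
  intro m hm
  obtain ⟨k, rfl⟩ := Nat.exists_eq_add_of_le' hm
  rw [← add_assoc, add_right_comm, Nat.add_sub_cancel, add_right_comm]
  exact keithSeq_replicate_one_le hnz k
end

section
/- Let k = l·m where l ≥ m ≥ 2 are integers, let n ≥ 1, and let X ⊆ {1,2,...,k}^n be an antichain with respect to the product order. Then |X| < (m/2)·k^n / n^{1/2}. -/
open Finset in
/-- Averaging Sperner's theorem over the `k ^ n` Boolean cubes `∏ i, {c i, c i + 1}`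
(addition modulo `k`), which cover each point of `{0, …, k - 1} ^ n` exactly `2 ^ n` times. -/
theorem two_pow_mul_card_le_of_isAntichain {ι : Type*} [Fintype ι] [DecidableEq ι] {k : ℕ}
    [NeZero k] (hk : 2 ≤ k) (Y : Finset (ι → Fin k))
    (hY : IsAntichain (· ≤ ·) (Y : Set (ι → Fin k))) :
    2 ^ Fintype.card ι * #Y ≤
      k ^ Fintype.card ι * (Fintype.card ι).choose (Fintype.card ι / 2) := by
  have h10 : (1 : Fin k) ≠ 0 := by
    intro h
    have := congrArg Fin.val h
    rw [Fin.val_one', Fin.val_zero, Nat.mod_eq_of_lt (by omega)] at this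
    omega
  let e : Finset ι → ι → Fin k := fun S i ↦ if i ∈ S then 1 else 0
  have hfiber (S : Finset ι) : #{c : ι → Fin k | c + e S ∈ Y} = #Y :=
    card_bij (fun c _ ↦ c + e S) (by simp) (by simp)
      (fun y hy ↦ ⟨y - e S, by simpa using hy, by simp⟩)
  have hcube (c : ι → Fin k) :
      #{S : Finset ι | c + e S ∈ Y} ≤ (Fintype.card ι).choose (Fintype.card ι / 2) := by
    let T : Finset ι := {i | c i + 1 < c i}
    rw [← card_image_of_injective _ (symmDiff_left_injective T)]
    refine IsAntichain.sperner ?_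
    intro A hA B hB hAB hle
    simp only [coe_image, coe_filter, mem_univ, true_and, Set.mem_image, Set.mem_ofPred_eq]
      at hA hB
    obtain ⟨S, hS, rfl⟩ := hA
    obtain ⟨S', hS', rfl⟩ := hB
    refine hY hS hS' ?_ ?_
    · intro h
      apply hAB
      congr 1
      ext i
      have := congrFun (add_left_cancel h) i
      by_cases h1 : i ∈ S <;> by_cases h2 : i ∈ S' <;> simp_all [e]
    · intro i
      have hi := @hle i
      simp only [mem_symmDiff, T, mem_filter, mem_univ, true_and] at hi
      by_cases h1 : i ∈ S <;> by_cases h2 : i ∈ S' <;> by_cases h3 : c i + 1 < c i <;>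
        simp_all [e, le_of_lt]
  calc 2 ^ Fintype.card ι * #Y
      = ∑ S : Finset ι, #{c : ι → Fin k | c + e S ∈ Y} := by simp [hfiber]
    _ = ∑ c : ι → Fin k, #{S : Finset ι | c + e S ∈ Y} :=
        sum_card_bipartiteAbove_eq_sum_card_bipartiteBelow (fun S c ↦ c + e S ∈ Y)
    _ ≤ ∑ _c : ι → Fin k, (Fintype.card ι).choose (Fintype.card ι / 2) :=
        sum_le_sum fun c _ ↦ hcube c
    _ = _ := by simp

theorem Nat.two_mul_add_one_mul_centralBinom_sq_le (j : ℕ) :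
    (2 * j + 1) * j.centralBinom ^ 2 ≤ 16 ^ j := by
  induction j with
  | zero => simp
  | succ j ih =>
    have h := Nat.succ_mul_centralBinom_succ j
    refine le_of_mul_le_mul_left ?_ (show 0 < (j + 1) ^ 2 by positivity)
    calc (j + 1) ^ 2 * ((2 * (j + 1) + 1) * (j + 1).centralBinom ^ 2)
        = (2 * j + 3) * ((j + 1) * (j + 1).centralBinom) ^ 2 := by ring
      _ = 4 * ((2 * j + 3) * (2 * j + 1)) * ((2 * j + 1) * j.centralBinom ^ 2) := by
        rw [h]; ring
      _ ≤ 4 * (4 * (j + 1) ^ 2) * 16 ^ j :=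
        Nat.mul_le_mul (Nat.mul_le_mul_left 4 (by nlinarith)) ih
      _ = (j + 1) ^ 2 * 16 ^ (j + 1) := by ring

theorem Nat.succ_mul_choose_half_sq_le (n : ℕ) : (n + 1) * n.choose (n / 2) ^ 2 ≤ 4 ^ n := by
  obtain ⟨j, rfl | rfl⟩ := Nat.even_or_odd' n
  · have h := Nat.two_mul_add_one_mul_centralBinom_sq_le j
    rw [Nat.mul_div_cancel_left j two_pos, pow_mul]
    exact h
  · have h := Nat.two_mul_add_one_mul_centralBinom_sq_le (j + 1)
    have hc : (j + 1).centralBinom = 2 * (2 * j + 1).choose j := by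
      rw [Nat.centralBinom_eq_two_mul_choose, show 2 * (j + 1) = 2 * j + 1 + 1 by ring,
        Nat.choose_succ_succ, Nat.choose_symm_half]
      ring
    rw [hc, pow_succ 16] at h
    rw [show (2 * j + 1) / 2 = j by omega, pow_succ 4, pow_mul]
    norm_num at h ⊢
    nlinarith [sq_nonneg ((2 * j + 1).choose j)]

/-- If k = l·m with l ≥ m ≥ 2, any antichain X in P(k,n) = {1,…,k}^n with the product
order satisfies |X| < (m/2)·k^n/√n. -/
theorem antichain_bound_composite (k l m n : ℕ) (hm : 2 ≤ m) (hlm : m ≤ l)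
    (hk : k = l * m) (hn : 1 ≤ n)
    (X : Finset (Fin n → ℕ))
    (hmem : ∀ x ∈ X, ∀ i, 1 ≤ x i ∧ x i ≤ k)
    (hanti : IsAntichain (· ≤ ·) (X : Set (Fin n → ℕ))) :
    (X.card : ℝ) < ((m : ℝ) / 2) * (k : ℝ) ^ n / Real.sqrt n := by
  have hk2 : 2 ≤ k := by nlinarith
  have : NeZero k := ⟨by omega⟩
  let f : (Fin n → Fin k) → Fin n → ℕ := fun y i ↦ (y i : ℕ) + 1
  let Y : Finset (Fin n → Fin k) := {y | f y ∈ X}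
  have hf : ∀ y z, f y ≤ f z ↔ y ≤ z := by simp [f, Pi.le_def]
  have hXY : X.card ≤ Y.card := by
    refine Finset.card_le_card_of_surjOn f fun x hx ↦ ?_
    have hfx : f (fun i ↦ ⟨x i - 1, by have := hmem x hx i; omega⟩) = x := by
      ext i
      have := hmem x hx i
      simp only [f]
      omega
    exact ⟨_, by simpa [Y, hfx] using hx, hfx⟩
  have hY : IsAntichain (· ≤ ·) (Y : Set (Fin n → Fin k)) := by
    intro y hy z hz hne hle
    refine hne (le_antisymm hle ((hf z y).1 ?_))
    exact (hanti.eq (by simpa [Y] using hy) (by simpa [Y] using hz) ((hf y z).2 hle)).ge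
  have hcard : 2 ^ n * X.card ≤ k ^ n * n.choose (n / 2) := by
    simpa using (Nat.mul_le_mul_left _ hXY).trans (two_pow_mul_card_le_of_isAntichain hk2 Y hY)
  have hn0 : (0 : ℝ) < n := by exact_mod_cast hn
  have hchoose : √(n : ℝ) * n.choose (n / 2) < 2 ^ n := by
    refine lt_of_pow_lt_pow_left₀ 2 (by positivity) ?_
    have hpos : (0 : ℝ) < n.choose (n / 2) := by
      exact_mod_cast Nat.choose_pos (Nat.div_le_self n 2)
    have h : ((n : ℝ) + 1) * (n.choose (n / 2) : ℝ) ^ 2 ≤ 4 ^ n := by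
      exact_mod_cast Nat.succ_mul_choose_half_sq_le n
    rw [mul_pow, Real.sq_sqrt hn0.le, ← pow_mul, mul_comm n 2, pow_mul]
    norm_num
    nlinarith [pow_pos hpos 2]
  have hkn : (0 : ℝ) < (k : ℝ) ^ n := by positivity
  have hlt : (X.card : ℝ) * √(n : ℝ) < (k : ℝ) ^ n := by
    have hcard' : (2 : ℝ) ^ n * X.card ≤ (k : ℝ) ^ n * n.choose (n / 2) := by
      exact_mod_cast hcard
    refine lt_of_mul_lt_mul_left ?_ (show (0 : ℝ) ≤ 2 ^ n by positivity)
    calc (2 : ℝ) ^ n * (X.card * √(n : ℝ)) = 2 ^ n * X.card * √(n : ℝ) := by ring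
      _ ≤ (k : ℝ) ^ n * n.choose (n / 2) * √(n : ℝ) := by gcongr
      _ = (k : ℝ) ^ n * (√(n : ℝ) * n.choose (n / 2)) := by ring
      _ < (k : ℝ) ^ n * 2 ^ n := by gcongr
      _ = 2 ^ n * (k : ℝ) ^ n := by ring
  rw [lt_div_iff₀ (Real.sqrt_pos.2 hn0)]
  have hm' : (1 : ℝ) ≤ m / 2 := by
    have : (2 : ℝ) ≤ m := by exact_mod_cast hm
    linarith
  exact hlt.trans_le (le_mul_of_one_le_left hkn.le hm')
end

section
/- If k ≥ 2 is a power of 2 and n ≥ 1, then every antichain X ⊆ {1,2,...,k}^n with respect to the product order satisfies |X| < k^n/√n. -/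
theorem three_mul_add_one_mul_centralBinom_sq_le (m : ℕ) :
    (3 * m + 1) * m.centralBinom ^ 2 ≤ 16 ^ m := by
  induction m with
  | zero => simp
  | succ m ih =>
    have h := Nat.succ_mul_centralBinom_succ m
    refine Nat.le_of_mul_le_mul_left ?_ (show 0 < (m + 1) ^ 2 by positivity)
    calc (m + 1) ^ 2 * ((3 * (m + 1) + 1) * (m + 1).centralBinom ^ 2)
        = (3 * m + 4) * ((m + 1) * (m + 1).centralBinom) ^ 2 := by ring
      _ = 4 * ((3 * m + 4) * (2 * m + 1) ^ 2) * m.centralBinom ^ 2 := by rw [h]; ring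
      _ ≤ 4 * (4 * (m + 1) ^ 2 * (3 * m + 1)) * m.centralBinom ^ 2 := by
          gcongr ?_ * _
          nlinarith
      _ = 16 * (m + 1) ^ 2 * ((3 * m + 1) * m.centralBinom ^ 2) := by ring
      _ ≤ 16 * (m + 1) ^ 2 * 16 ^ m := by gcongr
      _ = (m + 1) ^ 2 * 16 ^ (m + 1) := by ring

theorem mul_choose_half_sq_lt (n : ℕ) : n * n.choose (n / 2) ^ 2 < 4 ^ n := by
  obtain ⟨m, rfl | rfl⟩ := n.even_or_odd'
  · have h := three_mul_add_one_mul_centralBinom_sq_le m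
    have hpos : 0 < m.centralBinom ^ 2 := pow_pos m.centralBinom_pos 2
    rw [pow_mul, Nat.mul_div_cancel_left m two_pos, ← Nat.centralBinom_eq_two_mul_choose]
    norm_num
    nlinarith
  · have h := three_mul_add_one_mul_centralBinom_sq_le (m + 1)
    have hpos : 0 < (m + 1).centralBinom ^ 2 := pow_pos (m + 1).centralBinom_pos 2
    have hc : (m + 1).centralBinom = 2 * (2 * m + 1).choose m := by
      rw [Nat.centralBinom_eq_two_mul_choose, show 2 * (m + 1) = 2 * m + 1 + 1 by ring,
        Nat.choose_succ_succ, ← Nat.choose_symm_half m]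
      ring
    rw [show (2 * m + 1) / 2 = m by lia, pow_succ 4, pow_mul 4]
    rw [hc] at h hpos
    norm_num [pow_succ 16 m] at h ⊢
    nlinarith

/-- Two points in the same product of pairs `{2a+1, 2a+2}` are compared by their sets of even
coordinates, so an antichain inside such a product obeys Sperner's bound. -/
theorem card_le_choose_half_of_isAntichain_of_div_two_eq {n : ℕ} (Y : Finset (Fin n → ℕ))
    (a : Fin n → ℕ) (hpos : ∀ x ∈ Y, ∀ i, 1 ≤ x i) (ha : ∀ x ∈ Y, ∀ i, (x i - 1) / 2 = a i)
    (hanti : IsAntichain (· ≤ ·) (Y : Set (Fin n → ℕ))) :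
    Y.card ≤ n.choose (n / 2) := by
  let e : (Fin n → ℕ) → Finset (Fin n) := fun x => Finset.univ.filter fun i => x i % 2 = 0
  have hle : ∀ x ∈ Y, ∀ y ∈ Y, e x ⊆ e y → x ≤ y := by
    intro x hx y hy hxy i
    have hi : x i % 2 = 0 → y i % 2 = 0 := by
      simpa [e] using @hxy i
    have := hpos x hx i
    have := hpos y hy i
    have := ha x hx i
    have := ha y hy i
    lia
  have hinj : Set.InjOn e Y := fun x hx y hy hxy =>
    le_antisymm (hle x hx y hy hxy.subset) (hle y hy x hx hxy.symm.subset)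
  have himg : IsAntichain (· ⊆ ·) ((Y.image e : Finset (Finset (Fin n))) : Set (Finset (Fin n))) := by
    intro s hs t ht hne hst
    obtain ⟨x, hx, rfl⟩ := Finset.mem_image.1 hs
    obtain ⟨y, hy, rfl⟩ := Finset.mem_image.1 ht
    exact hanti hx hy (fun h => hne (congrArg e h)) (hle x hx y hy hst)
  simpa [Finset.card_image_of_injOn hinj] using himg.sperner

theorem card_le_choose_half_mul_pow_of_isAntichain (m n : ℕ) (X : Finset (Fin n → ℕ))
    (hmem : ∀ x ∈ X, ∀ i, 1 ≤ x i ∧ x i ≤ 2 * m)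
    (hanti : IsAntichain (· ≤ ·) (X : Set (Fin n → ℕ))) :
    X.card ≤ n.choose (n / 2) * m ^ n := by
  let f : (Fin n → ℕ) → Fin n → ℕ := fun x i => (x i - 1) / 2
  have hmaps : ∀ x ∈ X, f x ∈ Fintype.piFinset fun _ : Fin n => Finset.range m := by
    intro x hx
    simp only [Fintype.mem_piFinset, Finset.mem_range, f]
    intro i
    have := hmem x hx i
    lia
  have h := Finset.card_le_mul_card_image_of_maps_to hmaps (n.choose (n / 2)) fun a _ =>
    card_le_choose_half_of_isAntichain_of_div_two_eq (X.filter fun x => f x = a) a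
      (fun x hx i => (hmem x (Finset.mem_filter.1 hx).1 i).1)
      (fun x hx i => congrFun (Finset.mem_filter.1 hx).2 i)
      (hanti.subset (Finset.coe_subset.2 (Finset.filter_subset _ _)))
  simpa using h

/-- If k ≥ 2 is a power of 2, any antichain X in P(k,n) = {1,…,k}^n with the product
order satisfies |X| < k^n/√n. -/
theorem antichain_bound_pow_two (k n : ℕ) (hk : 2 ≤ k) (hpow : ∃ j : ℕ, k = 2 ^ j)
    (hn : 1 ≤ n)
    (X : Finset (Fin n → ℕ))
    (hmem : ∀ x ∈ X, ∀ i, 1 ≤ x i ∧ x i ≤ k)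
    (hanti : IsAntichain (· ≤ ·) (X : Set (Fin n → ℕ))) :
    (X.card : ℝ) < (k : ℝ) ^ n / Real.sqrt n := by
  obtain ⟨m, rfl⟩ : ∃ m, k = 2 * m := by
    obtain ⟨j, rfl⟩ := hpow
    cases j with
    | zero => simp at hk
    | succ j => exact ⟨2 ^ j, pow_succ' 2 j⟩
  have hm : (0 : ℝ) < m := by
    have : 0 < m := by lia
    exact_mod_cast this
  have hcard : (X.card : ℝ) ≤ n.choose (n / 2) * (m : ℝ) ^ n := by
    exact_mod_cast card_le_choose_half_mul_pow_of_isAntichain m n X hmem hanti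
  have hchoose : (n.choose (n / 2) : ℝ) * √n < 2 ^ n := by
    refine lt_of_pow_lt_pow_left₀ 2 (by positivity) ?_
    rw [mul_pow, Real.sq_sqrt n.cast_nonneg, ← pow_mul, mul_comm n 2, pow_mul, mul_comm]
    norm_num
    exact_mod_cast mul_choose_half_sq_lt n
  rw [lt_div_iff₀ (Real.sqrt_pos.2 (by exact_mod_cast hn))]
  calc (X.card : ℝ) * √n ≤ n.choose (n / 2) * (m : ℝ) ^ n * √n := by gcongr
    _ = n.choose (n / 2) * √n * (m : ℝ) ^ n := by ring
    _ < 2 ^ n * (m : ℝ) ^ n := by gcongr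
    _ = ((2 * m : ℕ) : ℝ) ^ n := by push_cast; rw [mul_pow]
end

section
/- Let a ∈ {1,...,9} and n ≥ 2, and let N = a·(10^n − 1)/9 (the rep-digit with n digits all equal to a) and M = (10^n − 1)/9 (the repunit with n digits). Then K^N_m = a·K^M_m for every m ≥ 1; consequently, N is a Keith number if and only if M is a Keith number. -/
/-- A Keith number: a positive integer with at least 2 decimal digits that occurs in the
Keith sequence generated by its own decimal digits (most significant first). -/
def IsKeith (N : ℕ) : Prop :=
  2 ≤ (Nat.digits 10 N).length ∧
    ∃ m, 1 ≤ m ∧ keithSeq ((Nat.digits 10 N).reverse) m = N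

theorem ten_pow_succ_sub_one_div_nine (n : ℕ) :
    (10 ^ (n + 1) - 1) / 9 = 1 + 10 * ((10 ^ n - 1) / 9) := by
  have hdvd : 9 ∣ 10 ^ n - 1 := by simpa using Nat.sub_dvd_pow_sub_pow 10 1 n
  have hpos : 0 < 10 ^ n := by positivity
  rw [pow_succ]
  omega

theorem digits_repdigit {a : ℕ} (ha1 : 1 ≤ a) (ha9 : a ≤ 9) (n : ℕ) :
    Nat.digits 10 (a * ((10 ^ n - 1) / 9)) = List.replicate n a := by
  induction n with
  | zero => simp
  | succ n ih =>
    rw [ten_pow_succ_sub_one_div_nine, mul_add, mul_one, mul_left_comm,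
      Nat.digits_add 10 (by norm_num) _ _ (by omega) (Or.inl (by omega)), ih,
      List.replicate_succ]

theorem digits_repunit (n : ℕ) :
    Nat.digits 10 ((10 ^ n - 1) / 9) = List.replicate n 1 := by
  simpa using digits_repdigit le_rfl (by norm_num : 1 ≤ 9) n

theorem getD_map_mul (c : ℕ) (l : List ℕ) (i : ℕ) :
    (l.map (c * ·)).getD i 0 = c * l.getD i 0 := by
  simpa using List.getD_map (l := l) (d := 0) (n := i) (c * ·)

theorem sum_map_mul (c : ℕ) (l : List ℕ) : (l.map (c * ·)).sum = c * l.sum := by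
  induction l with
  | nil => simp
  | cons x l ih => simp only [List.map_cons, List.sum_cons, ih, mul_add]

theorem keithList_map_mul (c : ℕ) (l : List ℕ) (m : ℕ) :
    keithList (l.map (c * ·)) m = (keithList l m).map (c * ·) := by
  induction m with
  | zero => rfl
  | succ m ih =>
    simp only [keithList, ih, List.length_map, List.map_append, List.map_cons, List.map_nil,
      getD_map_mul, ← List.map_drop, sum_map_mul, mul_ite]

theorem keithSeq_map_mul (c : ℕ) (l : List ℕ) (m : ℕ) :
    keithSeq (l.map (c * ·)) m = c * keithSeq l m := by
  rw [keithSeq, keithSeq, keithList_map_mul, getD_map_mul]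

theorem keithSeq_repdigit {a : ℕ} (ha1 : 1 ≤ a) (ha9 : a ≤ 9) (n m : ℕ) :
    keithSeq ((Nat.digits 10 (a * ((10 ^ n - 1) / 9))).reverse) m
      = a * keithSeq ((Nat.digits 10 ((10 ^ n - 1) / 9)).reverse) m := by
  rw [digits_repdigit ha1 ha9, digits_repunit, ← keithSeq_map_mul]
  simp

/-- For a ∈ {1,…,9}, n ≥ 2, the rep-digit N = a·(10^n−1)/9 and the repunit
M = (10^n−1)/9 satisfy K^N_m = a·K^M_m for all m ≥ 1; consequently N is a Keith number
iff M is. -/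
theorem repdigit_keith_iff_repunit (a n : ℕ) (ha1 : 1 ≤ a) (ha9 : a ≤ 9) (hn : 2 ≤ n) :
    (∀ m, 1 ≤ m →
      keithSeq ((Nat.digits 10 (a * ((10 ^ n - 1) / 9))).reverse) m
        = a * keithSeq ((Nat.digits 10 ((10 ^ n - 1) / 9)).reverse) m) ∧
    (IsKeith (a * ((10 ^ n - 1) / 9)) ↔ IsKeith ((10 ^ n - 1) / 9)) := by
  refine ⟨fun m _ => keithSeq_repdigit ha1 ha9 n m, ?_⟩
  simp only [IsKeith, keithSeq_repdigit ha1 ha9, Nat.mul_right_inj (by omega : a ≠ 0)]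
  simp only [digits_repdigit ha1 ha9, digits_repunit, List.length_replicate]
end
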